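/- Let E, F, G be real Banach spaces, let T : E → F be a bounded linear operator, let K : E → G be a compact linear operator, and suppose there is a constant C such that ‖u‖_E ≤ C(‖Tu‖_F + ‖Ku‖_G) for all u ∈ E. Then the range of T is closed in F, and there exists a constant C′ such that inf_{v ∈ ker T} ‖u − v‖_E ≤ C′ ‖Tu‖_F for all u ∈ E. -/

import Mathlib

open Filter Topology in
/-- If `‖u‖ ≤ C (‖T u‖ + ‖K u‖)` with `K` compact, then a bounded sequence whose image under `T`
converges to `y` has a subsequence converging to a preimage of `y`. -/
theorem exists_tendsto_subseq_of_norm_le_of_isCompactOperator {E F G : Type*}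
    [NormedAddCommGroup E] [NormedSpace ℝ E] [CompleteSpace E]
    [NormedAddCommGroup F] [NormedSpace ℝ F]
    [NormedAddCommGroup G] [NormedSpace ℝ G]
    (T : E →L[ℝ] F) (K : E →L[ℝ] G) (hK : IsCompactOperator K)
    {C : ℝ} (hC : ∀ u : E, ‖u‖ ≤ C * (‖T u‖ + ‖K u‖))
    {x : ℕ → E} {R : ℝ} (hx : ∀ n, ‖x n‖ ≤ R) {y : F}
    (hy : Tendsto (fun n => T (x n)) atTop (𝓝 y)) :
    ∃ a : E, T a = y ∧ ∃ φ : ℕ → ℕ, StrictMono φ ∧ Tendsto (x ∘ φ) atTop (𝓝 a) := by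
  obtain ⟨S, hS, hKS⟩ := hK.image_closedBall_subset_compact (f := K.toLinearMap) R
  obtain ⟨g, -, φ, hφ, hg⟩ := hS.tendsto_subseq (x := fun n => K (x n))
    fun n => hKS ⟨x n, by simpa using hx n, rfl⟩
  have hT := hy.comp hφ.tendsto_atTop
  have hanti : AntilipschitzWith (2 * C.toNNReal) (T.prod K) := by
    refine AddMonoidHomClass.antilipschitz_of_bound _ fun u => (hC u).trans ?_
    have h₁ : ‖T u‖ ≤ ‖T.prod K u‖ := norm_fst_le (T.prod K u)
    have h₂ : ‖K u‖ ≤ ‖T.prod K u‖ := norm_snd_le (T.prod K u)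
    calc C * (‖T u‖ + ‖K u‖) ≤ C.toNNReal * (‖T.prod K u‖ + ‖T.prod K u‖) := by
          gcongr
          exact Real.le_coe_toNNReal C
      _ = (2 * C.toNNReal : NNReal) * ‖T.prod K u‖ := by push_cast; ring
  have hemb := hanti.isClosedEmbedding (T.prod K).uniformContinuous
  have hlim : Tendsto (fun n => T.prod K (x (φ n))) atTop (𝓝 (y, g)) := hT.prodMk_nhds hg
  obtain ⟨a, ha⟩ := hemb.isClosed_range.mem_of_tendsto hlim (.of_forall fun n => ⟨_, rfl⟩)
  refine ⟨a, congrArg Prod.fst ha, φ, hφ, ?_⟩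
  rw [← ha] at hlim
  exact hemb.isInducing.tendsto_nhds_iff.2 hlim

open Filter Topology in
/-- If `‖u‖ ≤ C (‖T u‖ + ‖K u‖)` with `K` compact, then the distance to `ker T` is controlled
by `T`. -/
theorem exists_infDist_ker_le_of_isCompactOperator {E F G : Type*}
    [NormedAddCommGroup E] [NormedSpace ℝ E] [CompleteSpace E]
    [NormedAddCommGroup F] [NormedSpace ℝ F]
    [NormedAddCommGroup G] [NormedSpace ℝ G]
    (T : E →L[ℝ] F) (K : E →L[ℝ] G) (hK : IsCompactOperator K)
    {C : ℝ} (hC : ∀ u : E, ‖u‖ ≤ C * (‖T u‖ + ‖K u‖)) :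
    ∃ C' : ℝ, ∀ u : E, Metric.infDist u {v : E | T v = 0} ≤ C' * ‖T u‖ := by
  by_contra! h
  have hne : {v : E | T v = 0}.Nonempty := ⟨0, map_zero T⟩
  have key (n : ℕ) : ∃ w : E, ‖w‖ ≤ 2 ∧ ‖T w‖ ≤ 1 / ((n : ℝ) + 1) ∧
      ∀ v, T v = 0 → 1 ≤ ‖w - v‖ := by
    obtain ⟨u, hu⟩ := h (n + 1)
    set d := Metric.infDist u {v : E | T v = 0}
    have hd : 0 < d := lt_of_le_of_lt (by positivity) hu
    obtain ⟨v, hv, huv⟩ := (Metric.infDist_lt_iff hne).1 (show d < 2 * d by linarith)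
    replace hv : T v = 0 := hv
    rw [dist_eq_norm] at huv
    refine ⟨d⁻¹ • (u - v), ?_, ?_, fun z hz => ?_⟩
    · rw [norm_smul, norm_inv, Real.norm_of_nonneg hd.le, inv_mul_le_iff₀ hd]
      linarith
    · rw [map_smul, map_sub, hv, sub_zero, norm_smul, norm_inv, Real.norm_of_nonneg hd.le,
        inv_mul_le_iff₀ hd, mul_one_div, le_div_iff₀ (by positivity)]
      linarith
    · have hmem : v + d • z ∈ {v : E | T v = 0} := by simp [hv, hz]
      have hle : d ≤ ‖u - (v + d • z)‖ := by
        rw [← dist_eq_norm]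
        exact Metric.infDist_le_dist_of_mem hmem
      have heq : d⁻¹ • (u - v) - z = d⁻¹ • (u - (v + d • z)) := by
        rw [← sub_sub, smul_sub _ (u - v), inv_smul_smul₀ hd.ne']
      rwa [heq, norm_smul, norm_inv, Real.norm_of_nonneg hd.le, le_inv_mul_iff₀ hd, mul_one]
  choose w hw hTw hdist using key
  have hlim : Tendsto (fun n => T (w n)) atTop (𝓝 0) :=
    squeeze_zero_norm hTw tendsto_one_div_add_atTop_nhds_zero_nat
  obtain ⟨a, ha, φ, -, hφ⟩ :=
    exists_tendsto_subseq_of_norm_le_of_isCompactOperator T K hK hC hw hlim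
  have hle := ge_of_tendsto' (tendsto_iff_norm_sub_tendsto_zero.1 hφ) fun n => hdist (φ n) a ha
  linarith

open Filter Topology in
/-- If `‖u‖ ≤ C (‖T u‖ + ‖K u‖)` with `K` compact, then `T` has closed range. -/
theorem isClosed_range_of_norm_le_of_isCompactOperator {E F G : Type*}
    [NormedAddCommGroup E] [NormedSpace ℝ E] [CompleteSpace E]
    [NormedAddCommGroup F] [NormedSpace ℝ F]
    [NormedAddCommGroup G] [NormedSpace ℝ G]
    (T : E →L[ℝ] F) (K : E →L[ℝ] G) (hK : IsCompactOperator K)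
    {C : ℝ} (hC : ∀ u : E, ‖u‖ ≤ C * (‖T u‖ + ‖K u‖)) :
    IsClosed (Set.range T) := by
  obtain ⟨C', hC'⟩ := exists_infDist_ker_le_of_isCompactOperator T K hK hC
  refine isClosed_of_closure_subset fun y hy => ?_
  obtain ⟨z, hz, hzy⟩ := mem_closure_iff_seq_limit.1 hy
  choose u hu using hz
  obtain ⟨R, hR⟩ := (Metric.isBounded_range_of_tendsto z hzy).exists_norm_le
  have hpre (n : ℕ) : ∃ x : E, ‖x‖ ≤ |C'| * R + 1 ∧ T x = z n := by
    have hzR : ‖z n‖ ≤ R := hR _ ⟨n, rfl⟩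
    have hlt : Metric.infDist (u n) {v : E | T v = 0} < |C'| * R + 1 := by
      refine lt_of_le_of_lt ((hC' (u n)).trans ?_) (lt_add_one _)
      rw [hu]
      gcongr
      exact le_abs_self C'
    have hne : {v : E | T v = 0}.Nonempty := ⟨0, map_zero T⟩
    obtain ⟨v, hv, huv⟩ := (Metric.infDist_lt_iff hne).1 hlt
    replace hv : T v = 0 := hv
    exact ⟨u n - v, by rw [← dist_eq_norm]; exact huv.le, by rw [map_sub, hv, sub_zero, hu]⟩
  choose x hx hTx using hpre
  obtain ⟨a, ha, -⟩ := exists_tendsto_subseq_of_norm_le_of_isCompactOperator T K hK hC hx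
    (by simpa only [hTx] using hzy)
  exact ⟨a, ha⟩

/-- Peetre-type lemma.  Let `E, F, G` be Banach spaces, `T : E → F`
bounded linear, `K : E → G` compact linear (the image of the closed unit ball is
relatively compact), and suppose `‖u‖ ≤ C(‖Tu‖ + ‖Ku‖)` for all `u`.  Then the range
of `T` is closed, and `inf_{v ∈ ker T} ‖u - v‖ ≤ C′‖Tu‖` for some constant `C′`. -/
theorem statement8
    {E F G : Type*}
    [NormedAddCommGroup E] [NormedSpace ℝ E] [CompleteSpace E]
    [NormedAddCommGroup F] [NormedSpace ℝ F] [CompleteSpace F]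
    [NormedAddCommGroup G] [NormedSpace ℝ G] [CompleteSpace G]
    (T : E →L[ℝ] F) (K : E →L[ℝ] G)
    (hK : IsCompact (closure (K '' Metric.closedBall 0 1)))
    (C : ℝ) (hC : ∀ u : E, ‖u‖ ≤ C * (‖T u‖ + ‖K u‖)) :
    IsClosed (Set.range T) ∧
      ∃ C' : ℝ, ∀ u : E, Metric.infDist u {v : E | T v = 0} ≤ C' * ‖T u‖ := by
  have hcomp : IsCompactOperator K :=
    (isCompactOperator_iff_isCompact_closure_image_closedBall K.toLinearMap one_pos).2 hK
  exact ⟨isClosed_range_of_norm_le_of_isCompactOperator T K hcomp hC,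
    exists_infDist_ker_le_of_isCompactOperator T K hcomp hC⟩
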